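/- Let G be an accessible graph and let v₁, v₂ be two cut vertices of G such that {v₁, v₂} is not an edge of G. If G∖{v₁} and G∖{v₂} are accessible, then G∖{v₁, v₂} is accessible. -/

import Mathlib

open SimpleGraph

universe u u'

/-- The number of connected components of the induced subgraph of `G` on the vertex set `A`. -/
noncomputable def cComp {V : Type u} (G : SimpleGraph V) (A : Set V) : ℕ :=
  Nat.card (G.induce A).ConnectedComponent

/-- `x` is a cut vertex of the induced subgraph of `G` on `A`: removing `x`
increases the number of connected components. -/
def CutVertexOn {V : Type u} (G : SimpleGraph V) (A : Set V) (x : V) : Prop :=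
  x ∈ A ∧ cComp G A < cComp G (A \ {x})

/-- `T` is a cutset of the induced subgraph of `G` on `A`: every `t ∈ T` is a
cut vertex of `G[A] ∖ (T ∖ {t})`. -/
def CutsetOn {V : Type u} [DecidableEq V] (G : SimpleGraph V) (A : Set V) (T : Finset V) :
    Prop :=
  ↑T ⊆ A ∧ ∀ t ∈ T, CutVertexOn G (A \ ↑(T.erase t)) t

/-- The binomial edge ideal of the induced subgraph of `G` on `A` is unmixed
(combinatorial characterization): `c(T) = |T| + c(∅)` for every cutset `T`. -/
def UnmixedOn {V : Type u} [DecidableEq V] (G : SimpleGraph V) (A : Set V) : Prop :=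
  ∀ T : Finset V, CutsetOn G A T → cComp G (A \ ↑T) = T.card + cComp G A

/-- The induced subgraph of `G` on `A` is accessible. -/
def AccessibleOn {V : Type u} [DecidableEq V] (G : SimpleGraph V) (A : Set V) : Prop :=
  UnmixedOn G A ∧
    ∀ T : Finset V, CutsetOn G A T → T.Nonempty → ∃ t ∈ T, CutsetOn G A (T.erase t)

/-- The graph `(G[A])_x`: add all edges between neighbours of `x` lying in `A`. -/
def cliqueAtOn {V : Type u} (G : SimpleGraph V) (A : Set V) (x : V) : SimpleGraph V :=
  G ⊔ SimpleGraph.fromRel (fun a b => a ∈ A ∧ b ∈ A ∧ G.Adj x a ∧ G.Adj x b)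

/-- The binomial edge ideal of the induced subgraph of `G` on `A` is strongly unmixed. -/
inductive StronglyUnmixedOn {V : Type u} [DecidableEq V] : SimpleGraph V → Set V → Prop
  | complete (G : SimpleGraph V) (A : Set V)
      (h : ∀ a b : A, (G.induce A).Reachable a b → a ≠ b → (G.induce A).Adj a b) :
      StronglyUnmixedOn G A
  | cut (G : SimpleGraph V) (A : Set V) (hU : UnmixedOn G A) (x : V)
      (hx : CutVertexOn G A x)
      (h1 : StronglyUnmixedOn G (A \ {x}))
      (h2 : StronglyUnmixedOn (cliqueAtOn G A x) A)
      (h3 : StronglyUnmixedOn (cliqueAtOn G A x) (A \ {x})) :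
      StronglyUnmixedOn G A

/-- `x` is a free vertex of `G`: the induced subgraph on `N(x) ∪ {x}` is complete. -/
def FreeVertex {V : Type u} (G : SimpleGraph V) (x : V) : Prop :=
  ∀ a b : V, G.Adj x a → G.Adj x b → a ≠ b → G.Adj a b

/-- Attach a whisker (pendant vertex) at each vertex of `Wv`.  `Sum.inl a` is the
original vertex `a` and `Sum.inr x` is the whisker vertex `f_x` attached at `x ∈ Wv`. -/
def whiskered {V : Type u} (G : SimpleGraph V) (Wv : Set V) : SimpleGraph (V ⊕ V) :=
  SimpleGraph.fromRel (fun a b =>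
    (∃ x y, G.Adj x y ∧ a = Sum.inl x ∧ b = Sum.inl y) ∨
    (∃ x ∈ Wv, a = Sum.inl x ∧ b = Sum.inr x))

/-- `B` is (the vertex set of) a block of `G`: a maximal connected induced
subgraph having no cut vertex. -/
def IsBlock {V : Type u} (G : SimpleGraph V) (B : Set V) : Prop :=
  (G.induce B).Connected ∧ (∀ x, ¬ CutVertexOn G B x) ∧
    ∀ B' : Set V, B ⊆ B' → (G.induce B').Connected → (∀ x, ¬ CutVertexOn G B' x) → B' = B

/-- Glue two graphs `G` and `H`, identifying the vertex `x` of `G` with the vertex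
`y` of `H` (the identified vertex is `Sum.inl x`). -/
def glueAt {V : Type u} {W : Type u'} (G : SimpleGraph V) (H : SimpleGraph W) (x : V) (y : W) :
    SimpleGraph (V ⊕ W) :=
  SimpleGraph.fromRel (fun a b =>
    (∃ p q, G.Adj p q ∧ a = Sum.inl p ∧ b = Sum.inl q) ∨
    (∃ p q, H.Adj p q ∧ p ≠ y ∧ q ≠ y ∧ a = Sum.inr p ∧ b = Sum.inr q) ∨
    (∃ q, H.Adj y q ∧ a = Sum.inl x ∧ b = Sum.inr q))

/-- The star product `K_m ⋆_r K_n`: two complete graphs, on `{x₁,…,x_m}` (the `inl`s)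
and `{y₁,…,y_n}` (the `inr`s), together with the matching edges `{x_i, y_i}` for `1 ≤ i ≤ r`
(indices `0,…,r-1` here). -/
def starProd (m n r : ℕ) : SimpleGraph (Fin m ⊕ Fin n) :=
  SimpleGraph.fromRel (fun a b =>
    (∃ x y : Fin m, a = Sum.inl x ∧ b = Sum.inl y) ∨
    (∃ x y : Fin n, a = Sum.inr x ∧ b = Sum.inr y) ∨
    (∃ (x : Fin m) (y : Fin n), (x : ℕ) = (y : ℕ) ∧ (x : ℕ) < r ∧
      a = Sum.inl x ∧ b = Sum.inr y))

/-- The vertices `x_i, y_i` for `2 ≤ i ≤ r` (indices `1,…,r-1` here), at which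
whiskers are attached to form `overline(K_m ⋆_r K_n)`. -/
def starWhisk (m n r : ℕ) : Set (Fin m ⊕ Fin n) :=
  {a | (∃ x : Fin m, a = Sum.inl x ∧ 1 ≤ (x : ℕ) ∧ (x : ℕ) < r) ∨
       (∃ y : Fin n, a = Sum.inr y ∧ 1 ≤ (y : ℕ) ∧ (y : ℕ) < r)}

/-- `a` and `b` both lie in `A` and are joined by a path of the induced subgraph of `G` on `A`. -/
def ReachIn {V : Type u} (G : SimpleGraph V) (A : Set V) (a b : V) : Prop :=
  ∃ (ha : a ∈ A) (hb : b ∈ A), (G.induce A).Reachable ⟨a, ha⟩ ⟨b, hb⟩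

/-- Auxiliary (connected case): `G[A]` has no cut vertex, or for every cut vertex `x`,
every connected component of `G[A] ∖ {x}` contains at most `r` cut vertices of `G[A] ∖ {x}`. -/
def RCutConnAux {V : Type u} (G : SimpleGraph V) (A : Set V) (r : ℕ) : Prop :=
  (∀ x, ¬ CutVertexOn G A x) ∨
    ∀ x, CutVertexOn G A x → ∀ a ∈ A \ {x},
      Set.ncard {w | CutVertexOn G (A \ {x}) w ∧ ReachIn G (A \ {x}) a w} ≤ r

/-- `G[A]` is `r`-cut-connected: every connected component of `G[A]` satisfies the
condition of `RCutConnAux`. -/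
def RCutConn {V : Type u} (G : SimpleGraph V) (A : Set V) (r : ℕ) : Prop :=
  ∀ a ∈ A, RCutConnAux G {b | ReachIn G A a b} r

/-- `G[A]` is strongly `r`-cut-connected: it is `r`-cut-connected and, recursively,
`G[A] ∖ {x}` is strongly `r`-cut-connected for every cut vertex `x`. -/
inductive StronglyRCutConn {V : Type u} (r : ℕ) : SimpleGraph V → Set V → Prop
  | mk (G : SimpleGraph V) (A : Set V) (h1 : RCutConn G A r)
      (h2 : ∀ x, CutVertexOn G A x → StronglyRCutConn r G (A \ {x})) :
      StronglyRCutConn r G A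

section

variable {V : Type u} {G : SimpleGraph V} {A B : Set V} {a b c x v w s t : V}

namespace ReachIn

lemma left_mem (h : ReachIn G A a b) : a ∈ A := h.1

lemma right_mem (h : ReachIn G A a b) : b ∈ A := h.2.1

lemma refl (ha : a ∈ A) : ReachIn G A a a := ⟨ha, ha, .rfl⟩

lemma symm (h : ReachIn G A a b) : ReachIn G A b a := ⟨h.2.1, h.1, h.2.2.symm⟩

lemma trans (h : ReachIn G A a b) (h' : ReachIn G A b c) : ReachIn G A a c :=
  ⟨h.1, h'.2.1, h.2.2.trans h'.2.2⟩

lemma of_adj (ha : a ∈ A) (hb : b ∈ A) (h : G.Adj a b) : ReachIn G A a b :=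
  ⟨ha, hb, SimpleGraph.Adj.reachable (G := G.induce A) (u := ⟨a, ha⟩) (v := ⟨b, hb⟩) h⟩

lemma mono (hAB : A ⊆ B) (h : ReachIn G A a b) : ReachIn G B a b :=
  ⟨hAB h.1, hAB h.2.1, h.2.2.map (SimpleGraph.induceHomOfLE G hAB).toHom⟩

/-- A path either avoids `x`, or its initial part reaches a neighbour of `x`. -/
lemma diff_or_exists_adj (h : ReachIn G A a b) (hax : a ≠ x) :
    ReachIn G (A \ {x}) a b ∨ ∃ n, G.Adj x n ∧ ReachIn G (A \ {x}) a n := by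
  obtain ⟨ha, hb, h⟩ := h
  rw [SimpleGraph.reachable_iff_reflTransGen] at h
  generalize hp : (⟨b, hb⟩ : A) = p at h
  obtain rfl : b = p := congrArg Subtype.val hp
  clear hp
  induction h with
  | refl => exact .inl (refl ⟨ha, hax⟩)
  | @tail p q _ hpq ih =>
    rcases ih p.2 with h | h
    · have hadj : G.Adj p q := hpq
      by_cases hq : (q : V) = x
      · exact .inr ⟨p, hq ▸ hadj.symm, h⟩
      · exact .inl (h.trans (of_adj h.right_mem ⟨q.2, hq⟩ hadj))
    · exact .inr h

end ReachIn

lemma exists_adj_of_not_reachIn (h : ReachIn G A a b) (hax : a ≠ x)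
    (hn : ¬ ReachIn G (A \ {x}) a b) : ∃ n, G.Adj x n ∧ ReachIn G (A \ {x}) a n :=
  (h.diff_or_exists_adj hax).resolve_left hn

lemma cutVertexOn_iff [Finite V] : CutVertexOn G A x ↔ x ∈ A ∧ ∃ a b,
    a ∈ A \ {x} ∧ b ∈ A \ {x} ∧ G.Adj x a ∧ G.Adj x b ∧ ¬ ReachIn G (A \ {x}) a b := by
  refine and_congr_right fun hx => ?_
  set f : (G.induce (A \ {x})).ConnectedComponent → (G.induce A).ConnectedComponent :=
    SimpleGraph.ConnectedComponent.map
      (SimpleGraph.induceHomOfLE G (Set.sdiff_subset (s := A) (t := {x}))).toHom with hf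
  constructor
  · intro h
    by_contra! hall
    refine absurd (Nat.card_le_card_of_injective f ?_) h.not_ge
    intro p q
    induction p using SimpleGraph.ConnectedComponent.ind with | _ p
    induction q using SimpleGraph.ConnectedComponent.ind with | _ q
    intro hpq
    have hr : ReachIn G A p q := ⟨p.2.1, q.2.1, SimpleGraph.ConnectedComponent.exact hpq⟩
    apply SimpleGraph.ConnectedComponent.sound
    by_contra hn
    have hn' : ¬ ReachIn G (A \ {x}) p q := fun h => hn h.2.2
    obtain ⟨n, hxn, hpn⟩ := exists_adj_of_not_reachIn hr p.2.2 hn'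
    obtain ⟨m, hxm, hqm⟩ :=
      exists_adj_of_not_reachIn hr.symm q.2.2 fun h => hn' h.symm
    exact hn' (hpn.trans ((hall n m hpn.right_mem hqm.right_mem hxn hxm).trans hqm.symm))
  · rintro ⟨a, b, ha, hb, hxa, hxb, hn⟩
    have hsurj : Function.Surjective f := by
      intro p
      induction p using SimpleGraph.ConnectedComponent.ind with | _ p
      by_cases hp : (p : V) = x
      · refine ⟨(G.induce (A \ {x})).connectedComponentMk ⟨a, ha⟩, ?_⟩
        refine SimpleGraph.ConnectedComponent.sound (SimpleGraph.Adj.reachable ?_)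
        change G.Adj a p
        exact hp ▸ hxa.symm
      · exact ⟨(G.induce (A \ {x})).connectedComponentMk ⟨p, p.2, hp⟩, rfl⟩
    refine lt_of_le_of_ne (Nat.card_le_card_of_surjective f hsurj) fun hcard => hn ?_
    have hinj := ((Nat.bijective_iff_surjective_and_card f).2 ⟨hsurj, hcard.symm⟩).1
    have hab : ReachIn G A a b := (ReachIn.of_adj ha.1 hx hxa.symm).trans
      (ReachIn.of_adj hx hb.1 hxb)
    refine ⟨ha, hb, SimpleGraph.ConnectedComponent.exact (hinj ?_)⟩
    exact SimpleGraph.ConnectedComponent.sound hab.2.2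

/-- Deleting a vertex that is not a cut vertex does not disconnect the remaining vertices. -/
lemma ReachIn.diff_of_not_cutVertexOn [Finite V] (h : ReachIn G A a b) (hv : v ∈ A)
    (hcut : ¬ CutVertexOn G A v) (ha : a ≠ v) (hb : b ≠ v) : ReachIn G (A \ {v}) a b := by
  by_contra hn
  obtain ⟨n, hvn, han⟩ := exists_adj_of_not_reachIn h ha hn
  obtain ⟨m, hvm, hbm⟩ := exists_adj_of_not_reachIn h.symm hb fun h => hn h.symm
  refine hcut (cutVertexOn_iff.2 ⟨hv, n, m, han.right_mem, hbm.right_mem, hvn, hvm, ?_⟩)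
  exact fun h => hn (han.trans (h.trans hbm.symm))

/-- Adding back a vertex `v` that is not a cut vertex preserves cut vertices. -/
lemma CutVertexOn.of_diff [Finite V] (h : CutVertexOn G (A \ {v}) x) (hv : v ∈ A)
    (hcut : ¬ CutVertexOn G (A \ {x}) v) : CutVertexOn G A x := by
  obtain ⟨hx, a, b, ha, hb, hxa, hxb, hn⟩ := cutVertexOn_iff.1 h
  refine cutVertexOn_iff.2 ⟨hx.1, a, b, ⟨ha.1.1, ha.2⟩, ⟨hb.1.1, hb.2⟩, hxa, hxb, fun hr => hn ?_⟩
  rw [Set.sdiff_sdiff_comm]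
  exact hr.diff_of_not_cutVertexOn ⟨hv, fun h => hx.2 h.symm⟩ hcut ha.1.2 hb.1.2

/-- A cut vertex remains one after deleting another vertex not adjacent to it, as long as its
neighbours are kept. -/
lemma CutVertexOn.diff_of_not_adj [Finite V] (h : CutVertexOn G A x) (hxv : x ≠ v)
    (hadj : ¬ G.Adj x v) : CutVertexOn G (A \ {v}) x := by
  obtain ⟨hx, a, b, ha, hb, hxa, hxb, hn⟩ := cutVertexOn_iff.1 h
  refine cutVertexOn_iff.2 ⟨⟨hx, hxv⟩, a, b, ⟨⟨ha.1, ?_⟩, ha.2⟩, ⟨⟨hb.1, ?_⟩, hb.2⟩, hxa, hxb,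
    fun hr => hn (hr.mono ?_)⟩
  · rintro rfl; exact hadj hxa
  · rintro rfl; exact hadj hxb
  · exact Set.sdiff_subset_sdiff_left Set.sdiff_subset

/-- If deleting `t` turns `v` into a cut vertex, then a vertex `s` which is a cut vertex both
before and after deleting `v` and `t` is also one after deleting `v` alone. -/
lemma CutVertexOn.diff_of_cutVertexOn_diff [Finite V] (hsA : CutVertexOn G A s)
    (hv : ¬ CutVertexOn G (A \ {s}) v) (hvt : CutVertexOn G ((A \ {s}) \ {t}) v)
    (hst : CutVertexOn G ((A \ {v}) \ {t}) s) : CutVertexOn G (A \ {v}) s := by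
  by_contra hs
  obtain ⟨-, a₀, b₀, ha₀, hb₀, hsa₀, hsb₀, hn₀⟩ := cutVertexOn_iff.1 hsA
  obtain ⟨⟨hvs, -⟩, x, y, hx, hy, hvx, hvy, hnxy⟩ := cutVertexOn_iff.1 hvt
  obtain ⟨hsm, a, b, ha, hb, hsa, hsb, hnab⟩ := cutVertexOn_iff.1 hst
  have key : ∀ a b, a ∈ (A \ {v}) \ {s} → b ∈ (A \ {v}) \ {s} → G.Adj s a → G.Adj s b →
      ReachIn G ((A \ {v}) \ {s}) a b := by
    intro a b ha hb hsa hsb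
    by_contra hn
    exact hs (cutVertexOn_iff.2 ⟨hsm.1, a, b, ha, hb, hsa, hsb, hn⟩)
  have h_at : ReachIn G (A \ {s}) a t := by
    have hab := key a b ⟨ha.1.1, ha.2⟩ ⟨hb.1.1, hb.2⟩ hsa hsb
    rw [Set.sdiff_sdiff_comm] at hnab
    obtain ⟨n, htn, han⟩ := exists_adj_of_not_reachIn hab ha.1.2 hnab
    by_cases htA : t ∈ A \ {s}
    · exact (han.mono (by intro z hz; exact ⟨hz.1.1.1, hz.1.2⟩)).trans
        (.of_adj ⟨han.right_mem.1.1.1, han.right_mem.1.2⟩ htA htn.symm)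
    · refine absurd (hab.mono ?_) hnab
      exact fun z hz => ⟨hz, fun h => htA (h ▸ ⟨hz.1.1, hz.2⟩)⟩
  have h_vt : ReachIn G (A \ {s}) v t := by
    have hxy : ReachIn G ((A \ {s}) \ {v}) x y := by
      by_contra hn
      exact hv (cutVertexOn_iff.2 ⟨hvs, x, y, ⟨hx.1.1, hx.2⟩, ⟨hy.1.1, hy.2⟩, hvx, hvy, hn⟩)
    rw [Set.sdiff_sdiff_comm] at hnxy
    obtain ⟨n, htn, hxn⟩ := exists_adj_of_not_reachIn hxy hx.1.2 hnxy
    by_cases htA : t ∈ A \ {s}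
    · exact (ReachIn.of_adj hvs hx.1.1 hvx).trans
        ((hxn.mono fun z hz => hz.1.1).trans
          (.of_adj hxn.right_mem.1.1 htA htn.symm))
    · refine absurd (hxy.mono ?_) hnxy
      exact fun z hz => ⟨hz, fun h => htA (h ▸ hz.1)⟩
  have all : ∀ z ∈ A \ {s}, G.Adj s z → ReachIn G (A \ {s}) z t := by
    intro z hz hsz
    by_cases hzv : z = v
    · exact hzv ▸ h_vt
    · refine ((key z a ⟨⟨hz.1, hzv⟩, hz.2⟩ ⟨ha.1.1, ha.2⟩ hsz hsa).mono ?_).trans h_at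
      exact fun z hz => ⟨hz.1.1, hz.2⟩
  exact hn₀ ((all a₀ ha₀ hsa₀).trans (all b₀ hb₀ hsb₀).symm)

section Cutsets

variable [DecidableEq V] {T : Finset V}

lemma sdiff_coe_erase_sdiff (ht : t ∈ T) : (A \ ↑(T.erase t)) \ {t} = A \ (↑T : Set V) := by
  ext y
  by_cases hy : y = t <;> simp_all

lemma UnmixedOn.cComp_diff_le (hU : UnmixedOn G A) (hT : ↑T ⊆ A) :
    cComp G (A \ ↑T) ≤ T.card + cComp G A := by
  induction hn : T.card generalizing T with
  | zero =>
    obtain rfl := Finset.card_eq_zero.1 hn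
    simp
  | succ n ih =>
    by_cases hc : CutsetOn G A T
    · exact hn ▸ (hU T hc).le
    · obtain ⟨t, ht, hnt⟩ : ∃ t ∈ T, ¬ CutVertexOn G (A \ ↑(T.erase t)) t := by
        by_contra! h
        exact hc ⟨hT, h⟩
      have hle : cComp G (A \ ↑T) ≤ cComp G (A \ ↑(T.erase t)) := by
        by_contra! hlt
        exact hnt ⟨⟨hT ht, by simp⟩, by rwa [sdiff_coe_erase_sdiff ht]⟩
      have := ih (T := T.erase t) (fun y hy => hT (Finset.erase_subset _ _ hy))
        (by rw [Finset.card_erase_of_mem ht, hn]; rfl)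
      lia

/-- In the unmixed case, cutsets are exactly the sets attaining the bound `|T| + c(∅)`. -/
lemma UnmixedOn.cutsetOn_of_le (hU : UnmixedOn G A) (hT : ↑T ⊆ A)
    (hle : T.card + cComp G A ≤ cComp G (A \ ↑T)) : CutsetOn G A T := by
  refine ⟨hT, fun t ht => ⟨⟨hT ht, by simp⟩, ?_⟩⟩
  rw [sdiff_coe_erase_sdiff ht]
  have := hU.cComp_diff_le (T := T.erase t) (fun y hy => hT (Finset.erase_subset _ _ hy))
  have := Finset.card_erase_add_one ht
  lia

/-- If `v` is a cut vertex whose deletion keeps the graph unmixed, cutsets of the deletion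
extend by `v`. -/
lemma CutsetOn.insert_of_unmixedOn (hT : CutsetOn G (A \ {v}) T) (hU : UnmixedOn G A)
    (hv : CutVertexOn G A v) (hUv : UnmixedOn G (A \ {v})) : CutsetOn G A (insert v T) := by
  have hvT : v ∉ T := fun h => (hT.1 h).2 rfl
  apply hU.cutsetOn_of_le
  · rw [Finset.coe_insert]
    exact Set.insert_subset hv.1 (hT.1.trans Set.sdiff_subset)
  · have h1 := hUv T hT
    have h2 := hv.2
    rw [Finset.card_insert_of_notMem hvT, Finset.coe_insert, ← Set.singleton_union,
      ← Set.sdiff_sdiff]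
    lia

lemma CutsetOn.of_insert (hT : CutsetOn G A (insert v T)) (hv : v ∉ T) :
    CutsetOn G (A \ {v}) T := by
  refine ⟨fun y hy => ⟨hT.1 (by simp [Finset.mem_coe.1 hy]), ?_⟩, fun t ht => ?_⟩
  · rintro rfl; exact hv hy
  · have htv : t ≠ v := fun h => hv (h ▸ ht)
    have := hT.2 t (Finset.mem_insert_of_mem ht)
    rwa [Finset.erase_insert_of_ne htv.symm, Finset.coe_insert, ← Set.singleton_union,
      ← Set.sdiff_sdiff] at this

lemma CutsetOn.insert (hT : CutsetOn G (A \ {v}) T) (hv : CutVertexOn G (A \ ↑T) v) :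
    CutsetOn G A (insert v T) := by
  have hvT : v ∉ T := hv.1.2
  refine ⟨?_, fun t ht => ?_⟩
  · rw [Finset.coe_insert]
    exact Set.insert_subset hv.1.1 (hT.1.trans Set.sdiff_subset)
  · rcases Finset.mem_insert.1 ht with rfl | ht
    · rwa [Finset.erase_insert hvT]
    · have htv : t ≠ v := fun h => hvT (h ▸ ht)
      have := hT.2 t ht
      rwa [Finset.erase_insert_of_ne htv.symm, Finset.coe_insert, ← Set.singleton_union,
        ← Set.sdiff_sdiff]

lemma CutsetOn.cutVertexOn_of_insert (hT : CutsetOn G A (Insert.insert v T)) (hv : v ∉ T) :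
    CutVertexOn G (A \ ↑T) v := by
  simpa [Finset.erase_insert hv] using hT.2 v (Finset.mem_insert_self _ _)

/-- If `w` is not a cut vertex after deleting `v` and `T`, cutsets of the graph without `v, w` are
cutsets of the graph without `v`. -/
lemma CutsetOn.of_diff_of_not_cutVertexOn [Finite V] (hT : CutsetOn G (A \ {w}) T)
    (hw : w ∈ A) (hcut : ¬ CutVertexOn G (A \ ↑T) w) : CutsetOn G A T := by
  refine ⟨hT.1.trans Set.sdiff_subset, fun t ht => ?_⟩
  have hwT : w ∉ T := fun h => (hT.1 h).2 rfl
  have h := hT.2 t ht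
  rw [Set.sdiff_sdiff_comm] at h
  refine h.of_diff ⟨hw, fun h => hwT (Finset.mem_of_mem_erase h)⟩ ?_
  rwa [sdiff_coe_erase_sdiff ht]

lemma CutsetOn.insert_insert_of_not_cutVertexOn [Finite V]
    (hT : CutsetOn G ((A \ {v}) \ {w}) T) (hU : UnmixedOn G A)
    (hv : CutVertexOn G A v) (hw : CutVertexOn G A w) (hne : v ≠ w) (hadj : ¬ G.Adj v w)
    (hUv : UnmixedOn G (A \ {v})) (hUw : UnmixedOn G (A \ {w}))
    (hcut : ¬ CutVertexOn G ((A \ {v}) \ ↑T) w) :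
    CutsetOn G A (Insert.insert w (Insert.insert v T)) := by
  have hvT : v ∉ T := fun h => (hT.1 h).1.2 rfl
  have hTv : CutsetOn G (A \ {v}) T :=
    hT.of_diff_of_not_cutVertexOn ⟨hw.1, hne.symm⟩ hcut
  have hvB := (hTv.insert_of_unmixedOn hU hv hUv).cutVertexOn_of_insert hvT
  have hvB' := hvB.diff_of_not_adj hne hadj
  rw [Set.sdiff_sdiff_comm] at hvB' hT
  exact (hT.insert hvB').insert_of_unmixedOn hU hw hUw

/-- Cutsets extend by two non-adjacent cut vertices whose deletions are unmixed. -/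
lemma CutsetOn.insert_insert [Finite V] (hT : CutsetOn G ((A \ {v}) \ {w}) T) (hU : UnmixedOn G A)
    (hv : CutVertexOn G A v) (hw : CutVertexOn G A w) (hne : v ≠ w) (hadj : ¬ G.Adj v w)
    (hUv : UnmixedOn G (A \ {v})) (hUw : UnmixedOn G (A \ {w})) :
    CutsetOn G A (Insert.insert v (Insert.insert w T)) := by
  by_cases hcw : CutVertexOn G ((A \ {v}) \ ↑T) w
  · exact (hT.insert hcw).insert_of_unmixedOn hU hv hUv
  · rw [Finset.insert_comm]
    exact hT.insert_insert_of_not_cutVertexOn hU hv hw hne hadj hUv hUw hcw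

lemma AccessibleOn.diff_diff [Finite V] (hU : UnmixedOn G A) (hv : CutVertexOn G A v)
    (hw : CutVertexOn G A w) (hne : v ≠ w) (hadj : ¬ G.Adj v w)
    (hAv : AccessibleOn G (A \ {v})) (hUw : UnmixedOn G (A \ {w})) :
    AccessibleOn G ((A \ {v}) \ {w}) := by
  have extend : ∀ T, CutsetOn G ((A \ {v}) \ {w}) T → CutsetOn G A (insert v (insert w T)) :=
    fun T hT => hT.insert_insert hU hv hw hne hadj hAv.1 hUw
  have notMem : ∀ T, CutsetOn G ((A \ {v}) \ {w}) T → v ∉ insert w T ∧ w ∉ T := by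
    intro T hT
    have hvT : v ∉ T := fun h => (hT.1 h).1.2 rfl
    exact ⟨by simp [hne, hvT], fun h => (hT.1 h).2 rfl⟩
  have extend' : ∀ T, CutsetOn G ((A \ {v}) \ {w}) T → CutsetOn G (A \ {v}) (insert w T) :=
    fun T hT => (extend T hT).of_insert (notMem T hT).1
  have hwv : CutVertexOn G (A \ {v}) w := hw.diff_of_not_adj hne.symm fun h => hadj h.symm
  refine ⟨fun T hT => ?_, fun T hT hTne => ?_⟩
  · have h1 := hAv.1 _ (extend' T hT)
    have h2 := hAv.1 _ (extend' ∅ ⟨by simp, by simp⟩)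
    rw [Finset.card_insert_of_notMem (notMem T hT).2, Finset.coe_insert, ← Set.singleton_union,
      ← Set.sdiff_sdiff] at h1
    simp only [insert_empty_eq, Finset.coe_singleton, Finset.card_singleton] at h2
    lia
  · have hwT := (notMem T hT).2
    obtain ⟨x, hx, hxT⟩ := hAv.2 _ (extend' T hT) (Finset.insert_nonempty _ _)
    rcases Finset.mem_insert.1 hx with rfl | hx
    · rw [Finset.erase_insert hwT] at hxT
      obtain ⟨t, ht, htT⟩ := hAv.2 T hxT hTne
      refine ⟨t, ht, ?_⟩
      have hwT' : x ∉ T.erase t := fun h => hwT (Finset.mem_of_mem_erase h)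
      by_cases hcut : CutVertexOn G ((A \ {v}) \ ↑(T.erase t)) x
      · refine CutsetOn.of_insert (hAv.1.cutsetOn_of_le ?_ ?_) hwT'
        · rw [Finset.coe_insert]
          exact Set.insert_subset hwv.1 htT.1
        · have h1 := hAv.1 _ htT
          have h2 := hcut.2
          rw [Finset.card_insert_of_notMem hwT', Finset.coe_insert, ← Set.union_singleton,
            ← Set.sdiff_sdiff]
          lia
      · refine ⟨fun y hy => hT.1 (Finset.erase_subset _ _ hy), fun s hs => ?_⟩
        obtain ⟨hst, hsT⟩ := Finset.mem_erase.1 hs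
        have h := htT.2 s hs
        rw [Set.sdiff_sdiff_comm]
        refine h.diff_of_cutVertexOn_diff (t := t) ?_ ?_ ?_
        · rwa [sdiff_coe_erase_sdiff hs]
        · rw [sdiff_coe_erase_sdiff hs, sdiff_coe_erase_sdiff ht]
          exact (extend' T hT).cutVertexOn_of_insert hwT
        · rw [Set.sdiff_sdiff_comm (s := A \ {v}), Finset.erase_right_comm,
            sdiff_coe_erase_sdiff (Finset.mem_erase.2 ⟨hst.symm, ht⟩)]
          exact hT.2 s hsT
    · refine ⟨x, hx, CutsetOn.of_insert ?_ fun h => hwT (Finset.mem_of_mem_erase h)⟩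
      rwa [Finset.erase_insert_of_ne (ne_of_mem_of_not_mem hx hwT).symm] at hxT

end Cutsets

end

/-- if `G` is accessible, `v₁, v₂` are non-adjacent cut vertices of `G`,
and `G∖{v₁}`, `G∖{v₂}` are accessible, then `G∖{v₁,v₂}` is accessible. -/
theorem accessible_delete_two_cut_vertices {V : Type u} [Fintype V] [DecidableEq V]
    (G : SimpleGraph V) (v₁ v₂ : V) (hne : v₁ ≠ v₂)
    (hacc : AccessibleOn G Set.univ)
    (hc1 : CutVertexOn G Set.univ v₁) (hc2 : CutVertexOn G Set.univ v₂)
    (hnadj : ¬ G.Adj v₁ v₂)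
    (ha1 : AccessibleOn G ({v₁}ᶜ : Set V)) (ha2 : AccessibleOn G ({v₂}ᶜ : Set V)) :
    AccessibleOn G (({v₁, v₂} : Set V)ᶜ) := by
  have key := AccessibleOn.diff_diff (A := Set.univ) hacc.1 hc1 hc2 hne hnadj
    (by rwa [← Set.compl_eq_univ_sdiff]) (by rw [← Set.compl_eq_univ_sdiff]; exact ha2.1)
  rwa [Set.sdiff_sdiff, ← Set.compl_eq_univ_sdiff] at key
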